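/- arXiv:math/0411252 — 4 statements merged into one kernel-verified Lean document; each statement's English description precedes it below -/
import Mathlib

section
/- Let L₁ and L₂ be R-submodules of Rⁿ such that the quotients Rⁿ/L₁ and Rⁿ/L₂ are finite-dimensional as k-vector spaces. Then there exists an R-module automorphism g of Rⁿ with g(L₁) = L₂ if and only if Rⁿ/L₁ and Rⁿ/L₂ are isomorphic as R-modules. (This is the claim, used in the proof of Proposition 'set bijection', that a Schubert cell contained in the negative part of the affine Grassmannian of GL_n is determined by the isomorphism type of the quotient k[[t]]-module.) -/
/-- If the ranges of two endomorphisms `f` and `e` of a finite-dimensional vector space together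
span it, then `f` becomes invertible after adding a right multiple of `e`. -/
theorem Module.End.exists_isUnit_add_mul_of_range_sup_eq_top {K V : Type*} [Field K]
    [AddCommGroup V] [Module K V] [FiniteDimensional K V] (f e : Module.End K V)
    (h : LinearMap.range f ⊔ LinearMap.range e = ⊤) :
    ∃ u : Module.End K V, IsUnit (f + e * u) := by
  obtain ⟨r, hr⟩ := (LinearMap.ker f).subtype.exists_leftInverse_of_injective
    (LinearMap.ker f).ker_subtype
  have hdim : Module.finrank K (LinearMap.ker f) = Module.finrank K (V ⧸ LinearMap.range f) := by
    have h₁ := f.finrank_range_add_finrank_ker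
    have h₂ := (LinearMap.range f).finrank_quotient_add_finrank
    omega
  let φ := LinearEquiv.ofFinrankEq _ _ hdim
  have hsurj : Function.Surjective ((LinearMap.range f).mkQ ∘ₗ e) := by
    rw [← LinearMap.range_eq_top, LinearMap.range_comp,
      Submodule.map_mkQ_eq_top]
    exact h
  obtain ⟨ψ, hψ⟩ := Module.projective_lifting_property _ φ.toLinearMap hsurj
  refine ⟨ψ ∘ₗ r, ?_⟩
  rw [LinearMap.isUnit_iff_ker_eq_bot, LinearMap.ker_eq_bot']
  intro x hx
  replace hx : f x + e (ψ (r x)) = 0 := hx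
  have hrx : r x = 0 := by
    apply φ.injective
    have hπ := congrArg (LinearMap.range f).mkQ hx
    have hfx : (LinearMap.range f).mkQ (f x) = 0 := by simp
    rw [map_add, hfx, zero_add, map_zero] at hπ
    rw [map_zero, ← hπ]
    exact (LinearMap.congr_fun hψ (r x)).symm
  have hfx : f x = 0 := by simpa [hrx] using hx
  have hx' : r x = ⟨x, hfx⟩ := LinearMap.congr_fun hr ⟨x, hfx⟩
  exact congrArg Subtype.val (hx'.symm.trans hrx)

/-- Square matrix rings over a local ring have stable rank one. -/
theorem Matrix.exists_isUnit_add_mul_of_isLocalRing {R ι : Type*} [CommRing R] [IsLocalRing R]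
    [Fintype ι] [DecidableEq ι] (A B E : Matrix ι ι R) (h : A * B + E = 1) :
    ∃ U : Matrix ι ι R, IsUnit (A + E * U) := by
  let ρ := (IsLocalRing.residue R).mapMatrix (m := ι)
  let τ := Matrix.toLinAlgEquiv' (R := IsLocalRing.ResidueField R) (n := ι)
  have hsup : LinearMap.range (τ (ρ A)) ⊔ LinearMap.range (τ (ρ E)) = ⊤ := by
    refine eq_top_iff.mpr fun x _ ↦ ?_
    have hone : τ (ρ A) * τ (ρ B) + τ (ρ E) = 1 := by
      simp only [← map_mul, ← map_add, h, map_one]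
    have hx := LinearMap.congr_fun hone x
    exact Submodule.mem_sup.mpr ⟨_, ⟨τ (ρ B) x, rfl⟩, _, ⟨x, rfl⟩, hx⟩
  obtain ⟨u, hu⟩ := Module.End.exists_isUnit_add_mul_of_range_sup_eq_top _ _ hsup
  obtain ⟨U, hU⟩ : ∃ U, ρ U = τ.symm u := by
    choose s hs using IsLocalRing.residue_surjective (R := R)
    exact ⟨(τ.symm u).map s, Matrix.ext fun i j ↦ hs _⟩
  refine ⟨U, ?_⟩
  have hτ : τ (ρ (A + E * U)) = τ (ρ A) + τ (ρ E) * u := by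
    rw [map_add, map_mul, hU, map_add, map_mul, AlgEquiv.apply_symm_apply]
  rw [← hτ, MulEquiv.isUnit_map, Matrix.isUnit_iff_isUnit_det, ← RingHom.map_det] at hu
  exact (Matrix.isUnit_iff_isUnit_det _).mpr (isUnit_of_map_unit _ _ hu)

/-- Two surjections from a finite free module over a local ring onto the same module differ by
an automorphism of the source. -/
theorem IsLocalRing.exists_linearEquiv_comp_eq_of_surjective {R ι M : Type*} [CommRing R]
    [IsLocalRing R] [Finite ι] [AddCommGroup M] [Module R M] (p q : (ι → R) →ₗ[R] M)
    (hp : Function.Surjective p) (hq : Function.Surjective q) :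
    ∃ g : (ι → R) ≃ₗ[R] (ι → R), q ∘ₗ g.toLinearMap = p := by
  classical
  have := Fintype.ofFinite ι
  obtain ⟨f, hf⟩ := Module.projective_lifting_property q p hq
  obtain ⟨h, hh⟩ := Module.projective_lifting_property p q hp
  let τ := Matrix.toLinAlgEquiv' (R := R) (n := ι)
  obtain ⟨U, hU⟩ := Matrix.exists_isUnit_add_mul_of_isLocalRing (τ.symm f) (τ.symm h)
    (τ.symm (1 - f * h)) (by rw [← map_mul, ← map_add, add_sub_cancel, map_one])
  have hunit : IsUnit (f + (1 - f * h) * τ U) := by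
    simpa using hU.map τ
  refine ⟨LinearMap.GeneralLinearGroup.toLinearEquiv hunit.unit, LinearMap.ext fun x ↦ ?_⟩
  have hqf (y) : q (f y) = p y := LinearMap.congr_fun hf y
  have hph (y) : p (h y) = q y := LinearMap.congr_fun hh y
  change q (f x + (τ U x - f (h (τ U x)))) = p x
  rw [map_add, map_sub, hqf, hqf, hph, sub_self, add_zero]

/-- A Schubert cell contained in the negative part of the affine Grassmannian of `GL_n`
is determined by the isomorphism type of the quotient `k⟦t⟧`-module: two lattices
`L₁, L₂ ⊆ R^n` (with finite-dimensional quotients over `k`) are related by an `R`-module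
automorphism of `R^n` if and only if the quotients `R^n/L₁` and `R^n/L₂` are isomorphic
as `R`-modules, where `R = k⟦t⟧`. -/
theorem schubert_cell_determined_by_quotient
    (k : Type*) [Field k] (n : ℕ)
    (L₁ L₂ : Submodule (PowerSeries k) (Fin n → PowerSeries k))
    [FiniteDimensional k ((Fin n → PowerSeries k) ⧸ L₁)]
    [FiniteDimensional k ((Fin n → PowerSeries k) ⧸ L₂)] :
    (∃ g : (Fin n → PowerSeries k) ≃ₗ[PowerSeries k] (Fin n → PowerSeries k),
        L₁.map g.toLinearMap = L₂) ↔
      Nonempty (((Fin n → PowerSeries k) ⧸ L₁) ≃ₗ[PowerSeries k]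
        ((Fin n → PowerSeries k) ⧸ L₂)) := by
  constructor
  · rintro ⟨g, hg⟩
    exact ⟨Submodule.Quotient.equiv L₁ L₂ g hg⟩
  · rintro ⟨e⟩
    obtain ⟨g, hg⟩ := IsLocalRing.exists_linearEquiv_comp_eq_of_surjective
      (e.toLinearMap ∘ₗ L₁.mkQ) L₂.mkQ (e.surjective.comp L₁.mkQ_surjective) L₂.mkQ_surjective
    have hcomap : L₂.comap g.toLinearMap = L₁ := by
      have hker := congrArg LinearMap.ker hg
      rwa [LinearMap.ker_comp, LinearEquiv.ker_comp, Submodule.ker_mkQ, Submodule.ker_mkQ] at hker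
    exact ⟨g, by rw [← hcomap, Submodule.map_comap_eq_of_surjective g.surjective]⟩
end

section
/- Let k be a field, let d, n be natural numbers, and let A be a nilpotent k-linear endomorphism of k^d with dim_k ker A ≤ n. Then there exists an R-submodule M of Kⁿ containing the standard lattice Rⁿ with dim_k(M/Rⁿ) = d, together with a k-linear isomorphism φ : M/Rⁿ → k^d satisfying φ(t·x) = A(φ(x)) for all x ∈ M/Rⁿ. (This is the surjectivity of the natural map from the component Gr_E^{d,−} of the affine Grassmannian of lattices containing the standard one to the stack 𝒩ⁿ_d/GL_d of nilpotent d×d matrices with at most n Jordan blocks.) -/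
/-- The standard lattice `R^n ⊆ K^n`, where `R = k⟦t⟧` and `K = k((t))` is its fraction
field: the `R`-submodule of vectors all of whose coordinates lie in `R ⊆ K`. -/
noncomputable def stdLattice (k : Type*) [Field k] (K : Type*) [Field K]
    [Algebra (PowerSeries k) K] (n : ℕ) : Submodule (PowerSeries k) (Fin n → K) :=
  Submodule.pi Set.univ fun _ => LinearMap.range (Algebra.linearMap (PowerSeries k) K)

/-- A finite-dimensional subspace of dimension at most `n` is mapped injectively to `k^n` by
some linear map defined on the whole space. -/
theorem exists_linearMap_injOn_of_finrank_le {k V : Type*} [Field k] [AddCommGroup V]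
    [Module k V] (W : Submodule k V) [FiniteDimensional k W] {n : ℕ}
    (hW : Module.finrank k W ≤ n) :
    ∃ L : V →ₗ[k] (Fin n → k), ∀ w ∈ W, L w = 0 → w = 0 := by
  obtain ⟨g, hg⟩ := (finrank_le_iff_exists_linearMap (R := k) (M := W) (M' := Fin n → k)).1
    (hW.trans_eq (Module.finrank_fin_fun k).symm)
  obtain ⟨L, hL⟩ := g.exists_extend
  refine ⟨L, fun w hw h => ?_⟩
  have h1 : g ⟨w, hw⟩ = 0 := by rw [← hL]; exact h
  exact congrArg Subtype.val (hg (h1.trans (map_zero g).symm))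

theorem mem_stdLattice {k : Type*} [Field k] {K : Type*} [Field K]
    [Algebra (PowerSeries k) K] {n : ℕ} {x : Fin n → K} :
    x ∈ stdLattice k K n ↔ ∀ j, ∃ r : PowerSeries k, algebraMap (PowerSeries k) K r = x j := by
  simp [stdLattice, Submodule.mem_pi]

section PolarPart

variable {k : Type*} [Field k] {K : Type*} [Field K] [Algebra k K]
  [Algebra (PowerSeries k) K] {V : Type*} [AddCommGroup V] [Module k V] {n : ℕ}

/-- The `k`-linear map `v ↦ ∑_{i < N} L (A ^ i v) t^{-(i+1)}` from `V` to `K^n`. -/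
noncomputable def polarPart (K : Type*) [Field K] [Algebra k K] [Algebra (PowerSeries k) K]
    (A : Module.End k V) (L : V →ₗ[k] (Fin n → k)) (N : ℕ) : V →ₗ[k] (Fin n → K) :=
  LinearMap.pi fun j => ∑ i ∈ Finset.range N,
    ((LinearMap.proj j ∘ₗ L) ∘ₗ (A ^ i)).smulRight
      ((algebraMap (PowerSeries k) K PowerSeries.X)⁻¹ ^ (i + 1))

theorem polarPart_apply (A : Module.End k V) (L : V →ₗ[k] (Fin n → k)) (N : ℕ) (v : V)
    (j : Fin n) :
    polarPart K A L N v j = ∑ i ∈ Finset.range N,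
      L ((A ^ i) v) j • (algebraMap (PowerSeries k) K PowerSeries.X)⁻¹ ^ (i + 1) := by
  simp [polarPart]

theorem polarPart_eq_of_map_eq_zero {A : Module.End k V} (L : V →ₗ[k] (Fin n → k)) {N : ℕ}
    (hN : N ≠ 0) {v : V} (hv : A v = 0) (j : Fin n) :
    polarPart K A L N v j = L v j • (algebraMap (PowerSeries k) K PowerSeries.X)⁻¹ := by
  rw [polarPart_apply, Finset.sum_eq_single_of_mem 0 (by simpa using Nat.pos_of_ne_zero hN)]
  · simp
  · intro i _ hi
    obtain ⟨m, rfl⟩ := Nat.exists_eq_succ_of_ne_zero hi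
    simp [pow_succ, hv]

variable [IsScalarTower k (PowerSeries k) K] [IsFractionRing (PowerSeries k) K]

/-- Modulo the standard lattice, `polarPart` intertwines `A` and multiplication by `t`. -/
theorem X_smul_polarPart_sub_mem {A : Module.End k V} (L : V →ₗ[k] (Fin n → k)) {N : ℕ}
    (hA : A ^ N = 0) (v : V) :
    (PowerSeries.X : PowerSeries k) • polarPart K A L N v - polarPart K A L N (A v) ∈
      stdLattice k K n := by
  rw [mem_stdLattice]
  intro j
  have hX : algebraMap (PowerSeries k) K PowerSeries.X ≠ 0 := by simp
  have hshift : (PowerSeries.X : PowerSeries k) • polarPart K A L N v j =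
      ∑ i ∈ Finset.range N,
        L ((A ^ i) v) j • (algebraMap (PowerSeries k) K PowerSeries.X)⁻¹ ^ i := by
    rw [polarPart_apply, Finset.smul_sum]
    refine Finset.sum_congr rfl fun i _ => ?_
    rw [Algebra.smul_def, mul_smul_comm, pow_succ', mul_inv_cancel_left₀ hX]
  refine ⟨algebraMap k (PowerSeries k) (L v j), ?_⟩
  rw [Pi.sub_apply, Pi.smul_apply, hshift, polarPart_apply, eq_sub_iff_add_eq,
    ← IsScalarTower.algebraMap_apply]
  have htop := Finset.sum_range_succ (fun i => L ((A ^ i) v) j •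
    (algebraMap (PowerSeries k) K PowerSeries.X)⁻¹ ^ i) N
  rw [Finset.sum_range_succ'] at htop
  simp only [hA, LinearMap.zero_apply, map_zero, Pi.zero_apply, zero_smul, add_zero, pow_zero,
    Module.End.one_apply] at htop
  rw [← htop, add_comm, Algebra.algebraMap_eq_smul_one (R := k) (A := K)]
  simp only [pow_succ A, Module.End.mul_apply]

/-- A multiple `c t⁻¹` with `c ∈ k` is integral only if `c = 0`. -/
theorem eq_zero_of_algebraMap_eq_smul_inv_X {c : k} {r : PowerSeries k}
    (h : algebraMap (PowerSeries k) K r =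
      c • (algebraMap (PowerSeries k) K PowerSeries.X)⁻¹) : c = 0 := by
  have hX : algebraMap (PowerSeries k) K PowerSeries.X ≠ 0 := by simp
  have h1 : algebraMap (PowerSeries k) K (r * PowerSeries.X) =
      algebraMap (PowerSeries k) K (algebraMap k (PowerSeries k) c) := by
    rw [map_mul, h, smul_mul_assoc, inv_mul_cancel₀ hX, ← IsScalarTower.algebraMap_apply,
      Algebra.algebraMap_eq_smul_one]
  have h2 := congrArg PowerSeries.constantCoeff
    (IsFractionRing.injective (PowerSeries k) K h1)
  simpa [PowerSeries.algebraMap_apply] using h2.symm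

theorem eq_zero_of_polarPart_mem {A : Module.End k V} {L : V →ₗ[k] (Fin n → k)} {N : ℕ}
    (hA : A ^ N = 0) (hL : ∀ w ∈ LinearMap.ker A, L w = 0 → w = 0) {v : V}
    (hv : polarPart K A L N v ∈ stdLattice k K n) : v = 0 := by
  have key : ∀ m : ℕ, ∀ w : V, (A ^ m) w = 0 →
      polarPart K A L N w ∈ stdLattice k K n → w = 0 := by
    intro m
    induction m with
    | zero => intro w hw _; simpa using hw
    | succ m ih =>
      intro w hw hmem
      have hAw : A w = 0 := by
        refine ih (A w) (by simpa [pow_succ] using hw) ?_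
        have := Submodule.sub_mem _
          (Submodule.smul_mem _ (PowerSeries.X : PowerSeries k) hmem)
          (X_smul_polarPart_sub_mem (K := K) L hA w)
        simpa using this
      rcases eq_or_ne N 0 with rfl | hN
      · simpa using LinearMap.congr_fun hA w
      refine hL w hAw (funext fun j => ?_)
      obtain ⟨r, hr⟩ := mem_stdLattice.1 hmem j
      rw [polarPart_eq_of_map_eq_zero L hN hAw] at hr
      exact eq_zero_of_algebraMap_eq_smul_inv_X hr
  exact key N v (by simp [hA]) hv

theorem exists_smul_polarPart_sub_mem {A : Module.End k V} (L : V →ₗ[k] (Fin n → k)) {N : ℕ}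
    (hA : A ^ N = 0) (f : PowerSeries k) (v : V) :
    ∃ w, f • polarPart K A L N v - polarPart K A L N w ∈ stdLattice k K n := by
  have key : ∀ m : ℕ, ∀ (f : PowerSeries k) (v : V), (A ^ m) v = 0 →
      ∃ w, f • polarPart K A L N v - polarPart K A L N w ∈ stdLattice k K n := by
    intro m
    induction m with
    | zero =>
      intro f v hv
      obtain rfl : v = 0 := by simpa using hv
      exact ⟨0, by simp⟩
    | succ m ih =>
      intro f v hv
      obtain ⟨g, c, hf⟩ : ∃ (g : PowerSeries k) (c : k),
          f = g * PowerSeries.X + algebraMap k (PowerSeries k) c :=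
        ⟨_, _, PowerSeries.eq_shift_mul_X_add_const f⟩
      obtain ⟨w, hw⟩ := ih g (A v) (by simpa [pow_succ] using hv)
      refine ⟨w + c • v, ?_⟩
      have := Submodule.add_mem _ hw
        (Submodule.smul_mem _ g (X_smul_polarPart_sub_mem (K := K) L hA v))
      convert this using 1
      rw [hf, add_smul, mul_smul, algebraMap_smul, map_add, map_smul, smul_sub]
      abel
  exact key N f v (by simp [hA])

/-- The lattice spanned by the standard lattice and the image of `polarPart`. -/
noncomputable def polarLattice {A : Module.End k V} (L : V →ₗ[k] (Fin n → k)) {N : ℕ}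
    (hA : A ^ N = 0) : Submodule (PowerSeries k) (Fin n → K) where
  carrier := {x | ∃ v, x - polarPart K A L N v ∈ stdLattice k K n}
  zero_mem' := ⟨0, by simp⟩
  add_mem' := by
    rintro x y ⟨v, hv⟩ ⟨w, hw⟩
    refine ⟨v + w, ?_⟩
    rw [map_add, add_sub_add_comm]
    exact Submodule.add_mem _ hv hw
  smul_mem' := by
    rintro f x ⟨v, hv⟩
    obtain ⟨w, hw⟩ := exists_smul_polarPart_sub_mem (K := K) L hA f v
    refine ⟨w, ?_⟩
    have := Submodule.add_mem _ (Submodule.smul_mem _ f hv) hw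
    rwa [smul_sub, sub_add_sub_cancel] at this

theorem mem_polarLattice {A : Module.End k V} {L : V →ₗ[k] (Fin n → k)} {N : ℕ}
    {hA : A ^ N = 0} {x : Fin n → K} :
    x ∈ polarLattice L hA ↔ ∃ v, x - polarPart K A L N v ∈ stdLattice k K n :=
  Iff.rfl

theorem stdLattice_le_polarLattice {A : Module.End k V} (L : V →ₗ[k] (Fin n → k)) {N : ℕ}
    (hA : A ^ N = 0) : stdLattice k K n ≤ polarLattice L hA :=
  fun x hx => mem_polarLattice.2 ⟨0, by simpa using hx⟩

/-- The map `V → M / R^n` induced by `polarPart`, where `M` is `polarLattice`. -/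
noncomputable def toPolarQuotient (K : Type*) [Field K] [Algebra k K]
    [Algebra (PowerSeries k) K] [IsScalarTower k (PowerSeries k) K]
    [IsFractionRing (PowerSeries k) K] {A : Module.End k V} (L : V →ₗ[k] (Fin n → k)) {N : ℕ}
    (hA : A ^ N = 0) :
    V →ₗ[k] (polarLattice (K := K) L hA ⧸
      (stdLattice k K n).comap (polarLattice (K := K) L hA).subtype) where
  toFun v := Submodule.Quotient.mk
    ⟨polarPart K A L N v, mem_polarLattice.2 ⟨v, by simp⟩⟩
  map_add' v w := by
    rw [← Submodule.Quotient.mk_add]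
    congr 1
    exact Subtype.ext (map_add _ v w)
  map_smul' c v := by
    rw [RingHom.id_apply, ← Submodule.Quotient.mk_smul]
    congr 1
    exact Subtype.ext (map_smul _ c v)

theorem toPolarQuotient_map {A : Module.End k V} (L : V →ₗ[k] (Fin n → k)) {N : ℕ}
    (hA : A ^ N = 0) (v : V) :
    toPolarQuotient K L hA (A v) =
      (PowerSeries.X : PowerSeries k) • toPolarQuotient K L hA v := by
  symm
  exact (Submodule.Quotient.eq _).2 (X_smul_polarPart_sub_mem (K := K) L hA v)

theorem toPolarQuotient_bijective {A : Module.End k V} {L : V →ₗ[k] (Fin n → k)} {N : ℕ}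
    (hA : A ^ N = 0) (hL : ∀ w ∈ LinearMap.ker A, L w = 0 → w = 0) :
    Function.Bijective (toPolarQuotient K L hA) := by
  constructor
  · intro v w h
    have hmem : polarPart K A L N v - polarPart K A L N w ∈ stdLattice k K n :=
      (Submodule.Quotient.eq
        ((stdLattice k K n).comap (polarLattice (K := K) L hA).subtype)).1 h
    rw [← map_sub] at hmem
    exact sub_eq_zero.1 (eq_zero_of_polarPart_mem hA hL hmem)
  · intro q
    obtain ⟨⟨x, hx⟩, rfl⟩ := Submodule.Quotient.mk_surjective _ q
    obtain ⟨v, hv⟩ := mem_polarLattice.1 hx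
    refine ⟨v, Eq.symm ?_⟩
    exact (Submodule.Quotient.eq _).2 hv

end PolarPart

/-- Surjectivity of the natural map `Gr_E^{d,-} → 𝒩ⁿ_d/GL_d`: every nilpotent `k`-linear
endomorphism `A` of `k^d` with `dim_k ker A ≤ n` arises as multiplication by `t` on
`M/R^n` for some lattice `M ⊇ R^n` in `K^n` with `dim_k (M/R^n) = d`.  Here `R = k⟦t⟧`
and `K = k((t))` is its fraction field. -/
theorem grassmannian_to_nilpotent_surjective
    (k : Type*) [Field k] (K : Type*) [Field K] [Algebra k K]
    [Algebra (PowerSeries k) K] [IsScalarTower k (PowerSeries k) K]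
    [IsFractionRing (PowerSeries k) K] (d n : ℕ)
    (A : (Fin d → k) →ₗ[k] (Fin d → k)) (hA : IsNilpotent A)
    (hker : Module.finrank k (LinearMap.ker A) ≤ n) :
    ∃ M : Submodule (PowerSeries k) (Fin n → K),
      stdLattice k K n ≤ M ∧
      Module.finrank k (M ⧸ (stdLattice k K n).comap M.subtype) = d ∧
      ∃ φ : (M ⧸ (stdLattice k K n).comap M.subtype) ≃ₗ[k] (Fin d → k),
        ∀ x : M ⧸ (stdLattice k K n).comap M.subtype,
          φ ((PowerSeries.X : PowerSeries k) • x) = A (φ x) := by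
  obtain ⟨N, hN⟩ := hA
  obtain ⟨L, hL⟩ := exists_linearMap_injOn_of_finrank_le (LinearMap.ker A) hker
  let e := LinearEquiv.ofBijective (toPolarQuotient K L hN) (toPolarQuotient_bijective hN hL)
  refine ⟨polarLattice L hN, stdLattice_le_polarLattice L hN, ?_, e.symm, fun x => ?_⟩
  · rw [← e.finrank_eq, Module.finrank_fin_fun]
  · rw [LinearEquiv.symm_apply_eq]
    have h := toPolarQuotient_map (K := K) L hN (e.symm x)
    exact (h.trans (congrArg _ (e.apply_symm_apply x))).symm
end

section
/- Let M be an R-submodule of Kⁿ with Rⁿ ⊆ M and N := M/Rⁿ of k-dimension d, and let (d'₁,…,d'ₙ) be natural numbers with Σᵢ d'ᵢ = d. Then the map sending Lᵢ to Lᵢ/Rⁿ is a bijection between: (i) chains of R-submodules Rⁿ = L₀ ⊆ L₁ ⊆ … ⊆ Lₙ = M with dim_k(Lᵢ/Lᵢ₋₁) = d'ᵢ for all i, and (ii) chains of k-subspaces 0 = W₀ ⊆ W₁ ⊆ … ⊆ Wₙ = N with t·Wᵢ ⊆ Wᵢ and dim_k(Wᵢ/Wᵢ₋₁) = d'ᵢ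 for all i. (This is the identification, via the Cartesian diagram in Section 1.4, of the fiber p_n^{-1}(M) ∩ Conv^{d',−}(Gr_E) of the convolution diagram with the Springer fiber Fl(μ)^{A}, for A the multiplication-by-t endomorphism of N.) -/
theorem exists_X_pow_smul_mem_stdLattice
    (k : Type*) [Field k] (K : Type*) [Field K] [Algebra (PowerSeries k) K]
    [IsFractionRing (PowerSeries k) K] (n : ℕ) (x : Fin n → K) :
    ∃ m : ℕ, (PowerSeries.X : PowerSeries k) ^ m • x ∈ stdLattice k K n := by
  obtain ⟨b, hb⟩ := IsLocalization.exist_integer_multiples_of_finite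
    (nonZeroDivisors (PowerSeries k)) x
  have hb0 : (b : PowerSeries k) ≠ 0 := nonZeroDivisors.coe_ne_zero b
  obtain ⟨m, u, hu⟩ :=
    IsDiscreteValuationRing.eq_unit_mul_pow_irreducible hb0 PowerSeries.X_irreducible
  have hbx : (b : PowerSeries k) • x ∈ stdLattice k K n := by
    intro i _
    obtain ⟨a, ha⟩ := hb i
    exact ⟨a, ha⟩
  refine ⟨m, ?_⟩
  have h := (stdLattice k K n).smul_mem (↑u⁻¹ : PowerSeries k) hbx
  rwa [hu, smul_smul, ← mul_assoc, Units.inv_mul, one_mul] at h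

/-- On an `X`-power-torsion module, a subspace stable under `X` is stable under all power
series. -/
theorem PowerSeries.smul_mem_of_X_smul_mem {k N : Type*} [Field k] [AddCommGroup N]
    [Module (PowerSeries k) N] [Module k N] [IsScalarTower k (PowerSeries k) N]
    (htor : ∀ x : N, ∃ m : ℕ, (PowerSeries.X : PowerSeries k) ^ m • x = 0)
    (W : Submodule k N) (hW : ∀ x ∈ W, (PowerSeries.X : PowerSeries k) • x ∈ W)
    (f : PowerSeries k) {x : N} (hx : x ∈ W) : f • x ∈ W := by
  obtain ⟨m, hm⟩ := htor x
  have key : ∀ (m : ℕ) (f : PowerSeries k) (x : N), x ∈ W →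
      (PowerSeries.X : PowerSeries k) ^ m • x = 0 → f • x ∈ W := by
    intro m
    induction m with
    | zero =>
      intro f x _ h0
      rw [pow_zero, one_smul] at h0
      simp [h0]
    | succ m ih =>
      intro f x hx h0
      rw [PowerSeries.eq_shift_mul_X_add_const f, add_smul, mul_smul]
      refine W.add_mem (ih _ _ (hW x hx) (by rwa [smul_smul, ← pow_succ])) ?_
      have : PowerSeries.C (PowerSeries.constantCoeff f) • x
          = (PowerSeries.constantCoeff f) • x := by
        rw [← algebraMap_smul (PowerSeries k) (PowerSeries.constantCoeff f) x]
        rfl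
      rw [this]
      exact W.smul_mem _ hx
  exact key m f x hx hm

section SubmoduleQuotient

variable {R V : Type*} [CommRing R] [AddCommGroup V] [Module R V]

/-- The image of `A ∩ M` in `M / (S ∩ M)`. -/
def Submodule.imageInQuotient (M S A : Submodule R V) :
    Submodule R (M ⧸ S.comap M.subtype) :=
  (A.comap M.subtype).map (S.comap M.subtype).mkQ

theorem Submodule.mk_mem_imageInQuotient {M S A : Submodule R V} (hSA : S ≤ A) (x : M) :
    (S.comap M.subtype).mkQ x ∈ M.imageInQuotient S A ↔ (x : V) ∈ A := by
  rw [imageInQuotient, ← Submodule.mem_comap, Submodule.comap_map_mkQ,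
    sup_eq_right.2 (Submodule.comap_mono hSA)]
  rfl

theorem Submodule.imageInQuotient_injOn (M S : Submodule R V) :
    Set.InjOn (M.imageInQuotient S) (Set.Icc S M) := by
  have h : ∀ A ∈ Set.Icc S M, ∀ B ∈ Set.Icc S M,
      M.imageInQuotient S A = M.imageInQuotient S B → A ≤ B := by
    intro A hA B hB hAB x hx
    have := (mk_mem_imageInQuotient hA.1 ⟨x, hA.2 hx⟩).2 hx
    rw [hAB] at this
    exact (mk_mem_imageInQuotient hB.1 _).1 this
  exact fun A hA B hB hAB => le_antisymm (h A hA B hB hAB) (h B hB A hA hAB.symm)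

theorem Submodule.imageInQuotient_map_comap (M S : Submodule R V)
    (P : Submodule R (M ⧸ S.comap M.subtype)) :
    M.imageInQuotient S ((P.comap (S.comap M.subtype).mkQ).map M.subtype) = P := by
  rw [imageInQuotient, Submodule.comap_map_eq_of_injective M.injective_subtype,
    Submodule.map_comap_eq_of_surjective (Submodule.mkQ_surjective _)]

/-- The third isomorphism theorem, on dimensions over a subring of scalars. -/
theorem Submodule.finrank_imageInQuotient (k : Type*) [Field k] [Algebra k R] [Module k V]
    [IsScalarTower k R V] {M S A B : Submodule R V} (hSA : S ≤ A) (hAB : A ≤ B) (hBM : B ≤ M) :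
    Module.finrank k (((M.imageInQuotient S B).restrictScalars k) ⧸
      ((M.imageInQuotient S A).restrictScalars k).comap
        ((M.imageInQuotient S B).restrictScalars k).subtype)
      = Module.finrank k (B ⧸ A.comap B.subtype) := by
  let g : B →ₗ[R] M.imageInQuotient S B :=
    ((S.comap M.subtype).mkQ ∘ₗ Submodule.inclusion hBM).codRestrict _
      fun b => (mk_mem_imageInQuotient (hSA.trans hAB) (Submodule.inclusion hBM b)).2 b.2
  let g' : B →ₗ[k] (M.imageInQuotient S B).restrictScalars k := g.restrictScalars k
  let q := (((M.imageInQuotient S A).restrictScalars k).comap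
        ((M.imageInQuotient S B).restrictScalars k).subtype).mkQ
  have hg : Function.Surjective g' := by
    rintro ⟨_, x, hx, rfl⟩
    exact ⟨⟨x, hx⟩, rfl⟩
  have hker : LinearMap.ker (q ∘ₗ g') = (A.comap B.subtype).restrictScalars k := by
    ext b
    rw [LinearMap.ker_comp, Submodule.ker_mkQ]
    exact mk_mem_imageInQuotient hSA (Submodule.inclusion hBM b)
  have e := (q ∘ₗ g').quotKerEquivOfSurjective ((Submodule.mkQ_surjective _).comp hg)
  rw [← e.finrank_eq, hker]
  exact (Submodule.Quotient.restrictScalarsEquiv k (A.comap B.subtype)).finrank_eq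

end SubmoduleQuotient

/-- Identification of the fiber `p_n⁻¹(M) ∩ Conv^{d',-}(Gr_E)` of the convolution diagram
with the Springer fiber `Fl(μ)^A`, for `A` the multiplication-by-`t` endomorphism of
`N = M/R^n`: sending `Lᵢ` to `Lᵢ/R^n` is a bijection between chains of `R`-submodules
`R^n = L₀ ⊆ L₁ ⊆ ... ⊆ Lₙ = M` with `dim_k (Lᵢ/Lᵢ₋₁) = d'ᵢ` and chains of `t`-stable
`k`-subspaces `0 = W₀ ⊆ W₁ ⊆ ... ⊆ Wₙ = N` with `dim_k (Wᵢ/Wᵢ₋₁) = d'ᵢ`. -/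
theorem chains_of_lattices_biject_with_springer_fiber
    (k : Type*) [Field k] (K : Type*) [Field K] [Algebra k K]
    [Algebra (PowerSeries k) K] [IsScalarTower k (PowerSeries k) K]
    [IsFractionRing (PowerSeries k) K] (n : ℕ)
    (M : Submodule (PowerSeries k) (Fin n → K)) (hM : stdLattice k K n ≤ M)
    (d : ℕ) (hd : Module.finrank k (M ⧸ (stdLattice k K n).comap M.subtype) = d)
    [FiniteDimensional k (M ⧸ (stdLattice k K n).comap M.subtype)]
    (d' : Fin n → ℕ) (hd' : ∑ i, d' i = d) :
    Set.BijOn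
      (fun (L : Fin (n + 1) → Submodule (PowerSeries k) (Fin n → K)) (i : Fin (n + 1)) =>
        (((L i).comap M.subtype).map ((stdLattice k K n).comap M.subtype).mkQ).restrictScalars k)
      {L : Fin (n + 1) → Submodule (PowerSeries k) (Fin n → K) |
        L 0 = stdLattice k K n ∧ L (Fin.last n) = M ∧ Monotone L ∧
        ∀ i : Fin n,
          Module.finrank k
            (L i.succ ⧸ (L (i.castSucc)).comap (L i.succ).subtype) = d' i}
      {W : Fin (n + 1) →
          Submodule k (M ⧸ (stdLattice k K n).comap M.subtype) |
        W 0 = ⊥ ∧ W (Fin.last n) = ⊤ ∧ Monotone W ∧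
        (∀ (i : Fin (n + 1)) (x : M ⧸ (stdLattice k K n).comap M.subtype),
          x ∈ W i → (PowerSeries.X : PowerSeries k) • x ∈ W i) ∧
        ∀ i : Fin n,
          Module.finrank k
            (W i.succ ⧸ (W (i.castSucc)).comap (W i.succ).subtype) = d' i} := by
  set S := stdLattice k K n with hS
  have htor : ∀ x : M ⧸ S.comap M.subtype, ∃ m : ℕ,
      (PowerSeries.X : PowerSeries k) ^ m • x = 0 := by
    intro x
    obtain ⟨x, rfl⟩ := Submodule.mkQ_surjective _ x
    obtain ⟨m, hm⟩ := exists_X_pow_smul_mem_stdLattice k K n (x : Fin n → K)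
    refine ⟨m, ?_⟩
    rw [← map_smul, Submodule.mkQ_apply, Submodule.Quotient.mk_eq_zero]
    exact hm
  have hIcc : ∀ L : Fin (n + 1) → Submodule (PowerSeries k) (Fin n → K),
      L 0 = S → L (Fin.last n) = M → Monotone L → ∀ i, L i ∈ Set.Icc S M :=
    fun L h0 h1 hL i => ⟨h0 ▸ hL (Fin.zero_le i), h1 ▸ hL (Fin.le_last i)⟩
  refine ⟨?_, ?_, ?_⟩
  · rintro L ⟨h0, h1, hL, hdim⟩
    have hI := hIcc L h0 h1 hL
    refine ⟨?_, ?_, ?_, ?_, ?_⟩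
    · simp [h0]
    · simp [h1]
    · exact fun i j hij => Submodule.map_mono (Submodule.comap_mono (hL hij))
    · exact fun i x hx => Submodule.smul_mem (M.imageInQuotient S (L i)) _ hx
    · intro i
      rw [← hdim i]
      exact Submodule.finrank_imageInQuotient k (hI _).1 (hL i.castSucc_le_succ) (hI _).2
  · rintro L ⟨h0, h1, hL, -⟩ L' ⟨h0', h1', hL', -⟩ h
    funext i
    exact M.imageInQuotient_injOn S (hIcc L h0 h1 hL i) (hIcc L' h0' h1' hL' i)
      (Submodule.restrictScalars_injective k _ _ (congrFun h i))
  · rintro W ⟨h0, h1, hW, hX, hdim⟩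
    let P : Fin (n + 1) → Submodule (PowerSeries k) (M ⧸ S.comap M.subtype) := fun i =>
      { W i with
        smul_mem' := fun f _ hx => PowerSeries.smul_mem_of_X_smul_mem htor (W i) (hX i) f hx }
    let L : Fin (n + 1) → Submodule (PowerSeries k) (Fin n → K) := fun i =>
      ((P i).comap (S.comap M.subtype).mkQ).map M.subtype
    have hLW : ∀ i, (M.imageInQuotient S (L i)).restrictScalars k = W i := fun i => by
      rw [Submodule.imageInQuotient_map_comap]
      rfl
    have hL0 : L 0 = S := by
      have hP : P 0 = ⊥ := by
        ext x
        change x ∈ W 0 ↔ _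
        rw [h0, Submodule.mem_bot, Submodule.mem_bot]
      simp only [L, hP]
      rw [Submodule.comap_bot, Submodule.ker_mkQ, Submodule.map_comap_subtype,
        inf_eq_right.2 hM]
    have hL1 : L (Fin.last n) = M := by
      have hP : P (Fin.last n) = ⊤ := by
        ext x
        change x ∈ W (Fin.last n) ↔ _
        simp [h1]
      simp only [L, hP]
      simp
    have hL : Monotone L := fun i j hij =>
      Submodule.map_mono (Submodule.comap_mono (show P i ≤ P j from hW hij))
    have hI := hIcc L hL0 hL1 hL
    refine ⟨L, ⟨hL0, hL1, hL, fun i => ?_⟩, funext hLW⟩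
    have h := Submodule.finrank_imageInQuotient k (hI i.castSucc).1 (hL i.castSucc_le_succ)
      (hI i.succ).2
    rw [← h, hLW, hLW, hdim i]
end

section
/- Equip M := Rⁿ with the standard flag 0 = M⁰ ⊆ M¹ ⊆ … ⊆ Mⁿ = M, where Mⁱ is the R-span of the first i standard basis vectors. Let N be an R-module of finite length equipped with a filtration by R-submodules 0 = N⁰ ⊆ N¹ ⊆ … ⊆ Nⁿ = N, and set d'ᵢ := dim_k(Nⁱ/Nⁱ⁻¹). Then the k-vector space of filtered R-module homomorphisms {f ∈ Hom_R(M, N) : f(Mⁱ) ⊆ Nⁱ for all i} has dimension Σ_{i=1}^{n} d'ᵢ·(n − i + 1), which also equals Σ_{i=1}^{n} dim_k Nⁱ. (This is the key dimension computation in the proof of the smoothness Lemma for π_E^{Conv}: the scheme of filtered maps M'•₀ → N'• is a vector space of dimension Σᵢ d'ᵢ·(n−i+1).) -/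
/-- The standard flag `0 = M⁰ ⊆ M¹ ⊆ ... ⊆ Mⁿ = R^n` in the free module `R^n`:
`Mⁱ` is the `R`-span of the first `i` standard basis vectors. -/
noncomputable def stdFlag (R : Type*) [CommRing R] (n : ℕ) (i : Fin (n + 1)) :
    Submodule R (Fin n → R) :=
  Submodule.pi Set.univ fun j => if (i : ℕ) ≤ (j : ℕ) then ⊥ else ⊤

/-- The `k`-subspace of filtered `R`-module homomorphisms `R^n → N`, i.e. those
sending the `i`-th step of the standard flag into the `i`-th step `W i` of a given
filtration of `N`. -/
noncomputable def filteredHoms (k : Type*) [Field k] (n : ℕ)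
    (N : Type*) [AddCommGroup N] [Module (PowerSeries k) N]
    [Module k N] [IsScalarTower k (PowerSeries k) N]
    (W : Fin (n + 1) → Submodule (PowerSeries k) N) :
    Submodule k ((Fin n → PowerSeries k) →ₗ[PowerSeries k] N) where
  carrier := {f | ∀ i : Fin (n + 1), ∀ x ∈ stdFlag (PowerSeries k) n i, f x ∈ W i}
  add_mem' := fun hf hg i x hx => by
    simpa using (W i).add_mem (hf i x hx) (hg i x hx)
  zero_mem' := fun i x hx => by simp
  smul_mem' := by
    intro c f hf i x hx
    show c • f x ∈ W i
    rw [← algebraMap_smul (PowerSeries k) c (f x)]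
    exact (W i).smul_mem _ (hf i x hx)

/-- Every module of finite length over `k⟦X⟧` is finite-dimensional over `k`. -/
theorem IsFiniteLength.finite_of_powerSeries {k : Type*} [Field k] {N : Type*} [AddCommGroup N]
    [Module (PowerSeries k) N] [Module k N] [IsScalarTower k (PowerSeries k) N]
    (h : IsFiniteLength (PowerSeries k) N) : Module.Finite k N := by
  rename_i _ modk tower
  revert modk tower
  induction h with
  | of_subsingleton => intros; infer_instance
  | @of_simple_quotient M _ _ P hsimple _ ih =>
    intro _ _
    have : Module.Finite k P := ih
    have : Module.Finite k (M ⧸ P) := by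
      have : Nontrivial (M ⧸ P) := IsSimpleModule.nontrivial (PowerSeries k) _
      obtain ⟨v, hv⟩ := exists_ne (0 : M ⧸ P)
      have hker := IsLocalRing.eq_maximalIdeal
        (IsSimpleModule.ker_toSpanSingleton_isMaximal (PowerSeries k) hv)
      have hX : (PowerSeries.X : PowerSeries k) • v = 0 := by
        have : (PowerSeries.X : PowerSeries k) ∈ IsLocalRing.maximalIdeal (PowerSeries k) := by
          rw [PowerSeries.maximalIdeal_eq_span_X]
          exact Ideal.mem_span_singleton_self _
        rw [← hker] at this
        simpa using this
      refine Module.Finite.of_surjective (LinearMap.toSpanSingleton k (M ⧸ P) v) fun s => ?_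
      obtain ⟨p, rfl⟩ := IsSimpleModule.toSpanSingleton_surjective (PowerSeries k) hv s
      refine ⟨PowerSeries.constantCoeff p, ?_⟩
      conv_rhs => rw [PowerSeries.eq_shift_mul_X_add_const p]
      rw [LinearMap.toSpanSingleton_apply, LinearMap.toSpanSingleton_apply, add_smul, mul_smul, hX,
        smul_zero, zero_add, ← algebraMap_smul (PowerSeries k) (PowerSeries.constantCoeff p) v]
      rfl
    have : Module.Finite k (M ⧸ P.restrictScalars k) :=
      Module.Finite.equiv (Submodule.Quotient.restrictScalarsEquiv k P).symm
    have : Module.Finite k (P.restrictScalars k) := inferInstanceAs (Module.Finite k P)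
    exact Module.Finite.of_submodule_quotient (P.restrictScalars k)

/-- A filtered homomorphism out of `R^n` amounts to a choice of an element of each step of the
filtration. -/
theorem finrank_filteredHoms (k : Type*) [Field k] (n : ℕ)
    (N : Type*) [AddCommGroup N] [Module (PowerSeries k) N]
    [Module k N] [IsScalarTower k (PowerSeries k) N] [Module.Finite k N]
    (W : Fin (n + 1) → Submodule (PowerSeries k) N) (hW : Monotone W) :
    Module.finrank k (filteredHoms k n N W) = ∑ i : Fin n, Module.finrank k (W i.succ) := by
  have hmem (i : Fin n) : Pi.single i 1 ∈ stdFlag (PowerSeries k) n i.succ := by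
    simp only [stdFlag, Submodule.mem_pi]
    intro j _
    split_ifs with h
    · have hj : j ≠ i := by
        rintro rfl
        simp at h
      simp [hj]
    · trivial
  let φ : filteredHoms k n N W →ₗ[k] (i : Fin n) → W i.succ :=
    { toFun f i := ⟨f.1 (Pi.single i 1), f.2 i.succ _ (hmem i)⟩
      map_add' _ _ := rfl
      map_smul' _ _ := rfl }
  have hφ : Function.Bijective φ := by
    constructor
    · intro f g hfg
      refine Subtype.ext ((Pi.basisFun (PowerSeries k) (Fin n)).ext fun i => ?_)
      simpa [φ] using congrArg Subtype.val (congrFun hfg i)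
    · intro w
      let F := (Pi.basisFun (PowerSeries k) (Fin n)).constr (PowerSeries k) fun i => (w i : N)
      refine ⟨⟨F, fun i x hx => ?_⟩, funext fun i => Subtype.ext ?_⟩
      · rw [Module.Basis.constr_apply_fintype]
        refine Submodule.sum_mem _ fun j _ => ?_
        have hxj := (Submodule.mem_pi.mp hx) j (Set.mem_univ j)
        split_ifs at hxj with h
        · have : x j = 0 := hxj
          simp [this]
        · exact Submodule.smul_mem _ _ (hW (Fin.le_def.mpr (by simp; omega)) (w j).2)
      · change F (Pi.single i 1) = w i
        rw [← Pi.basisFun_apply, Module.Basis.constr_basis]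
  have hfin (i : Fin n) : Module.Finite k (W i.succ) :=
    inferInstanceAs (Module.Finite k ((W i.succ).restrictScalars k))
  rw [(LinearEquiv.ofBijective φ hφ).finrank_eq, Module.finrank_pi_fintype]

/-- Summation by parts for a sequence starting at zero. -/
theorem Fin.sum_mul_sub_eq_sum_succ {n : ℕ} (a : Fin (n + 1) → ℕ) (d : Fin n → ℕ) (h0 : a 0 = 0)
    (h : ∀ i : Fin n, d i + a i.castSucc = a i.succ) :
    ∑ i : Fin n, d i * (n - (i : ℕ)) = ∑ i : Fin n, a i.succ := by
  suffices ∑ i : Fin n, d i * (n - (i : ℕ)) = ∑ i : Fin n, a i.succ ∧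
      ∑ i : Fin n, d i = a (Fin.last n) from this.1
  induction n with
  | zero => simp [← h0]
  | succ n ih =>
    obtain ⟨ih₁, ih₂⟩ := ih (fun i => a i.castSucc) (fun i => d i.castSucc) h0
      fun i => h i.castSucc
    have hlast : d (Fin.last n) + a (Fin.last n).castSucc = a (Fin.last (n + 1)) :=
      h (Fin.last n)
    have hstep (i : Fin n) : d i.castSucc * (n + 1 - (i : ℕ)) =
        d i.castSucc * (n - (i : ℕ)) + d i.castSucc := by
      rw [Nat.sub_add_comm i.2.le, mul_add_one]
    simp only [Fin.sum_univ_castSucc, Fin.val_castSucc, Fin.val_last, Fin.succ_last, hstep,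
      Finset.sum_add_distrib, Fin.succ_castSucc, Nat.succ_eq_add_one, add_tsub_cancel_left, mul_one]
    omega

/-- The key dimension computation in the proof of the smoothness Lemma for `π_E^{Conv}`:
for a finite-length `R`-module `N` with a filtration `0 = N⁰ ⊆ ... ⊆ Nⁿ = N` whose
subquotients have `k`-dimensions `d'ᵢ`, the space of filtered `R`-module homomorphisms
`R^n → N` (with respect to the standard flag on `R^n`) has `k`-dimension
`Σᵢ d'ᵢ·(n − i + 1) = Σᵢ dim_k Nⁱ`. -/
theorem filtered_homs_dimension
    (k : Type*) [Field k] (n : ℕ)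
    (N : Type*) [AddCommGroup N] [Module (PowerSeries k) N]
    [Module k N] [IsScalarTower k (PowerSeries k) N]
    (hlen : IsFiniteLength (PowerSeries k) N)
    (W : Fin (n + 1) → Submodule (PowerSeries k) N)
    (hW0 : W 0 = ⊥) (hWn : W (Fin.last n) = ⊤) (hWmono : Monotone W)
    (d' : Fin n → ℕ)
    (hd' : ∀ i : Fin n,
      Module.finrank k (W i.succ ⧸ (W (i.castSucc)).comap (W i.succ).subtype) = d' i) :
    Module.finrank k (filteredHoms k n N W) = ∑ i : Fin n, d' i * (n - (i : ℕ)) ∧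
    Module.finrank k (filteredHoms k n N W) = ∑ i : Fin n, Module.finrank k (W i.succ) := by
  have : Module.Finite k N := hlen.finite_of_powerSeries
  have hfinrank := finrank_filteredHoms k n N W hWmono
  refine ⟨?_, hfinrank⟩
  rw [hfinrank]
  have hzero : Module.finrank k (W 0) = 0 := by
    rw [hW0]
    exact Module.finrank_zero_of_subsingleton
  refine (Fin.sum_mul_sub_eq_sum_succ (fun i => Module.finrank k (W i)) d' hzero fun i => ?_).symm
  let P := (W i.castSucc).comap (W i.succ).subtype
  have : Module.Finite k (W i.succ) :=
    inferInstanceAs (Module.Finite k ((W i.succ).restrictScalars k))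
  have hquot := (P.restrictScalars k).finrank_quotient_add_finrank
  rw [(Submodule.Quotient.restrictScalarsEquiv k P).finrank_eq, hd' i] at hquot
  have hP : Module.finrank k (P.restrictScalars k) = Module.finrank k (W i.castSucc) :=
    ((Submodule.comapSubtypeEquivOfLe (hWmono i.castSucc_lt_succ.le)).restrictScalars k).finrank_eq
  rwa [hP] at hquot
end
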